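/- (Multidimensional Carlson inequality) Let f be a probability density on ℝ^d with I(f) := ∫_{ℝ^d} |x|^{d+1} f(x) dx < ∞. Then ∫_{ℝ^d} √(f(x)) dx ≤ A_d · I(f)^{d/(2(d+1))}, where A_d = ((2π)^{(d+1)/2} / Γ((d+1)/2))^{1/2}. -/

import Mathlib

open MeasureTheory

lemma lintegral_gamma_aux (s r : ℝ) (hs : 0 < s) (hr : 0 < r) :
    ∫⁻ t in Set.Ioi (0:ℝ), ENNReal.ofReal (t ^ (s - 1) * Real.exp (-(r * t)))
      = ENNReal.ofReal ((1 / r) ^ s * Real.Gamma s) := by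
  have h := Real.integral_rpow_mul_exp_neg_mul_Ioi hs hr
  have hpos : 0 < (1 / r) ^ s * Real.Gamma s :=
    mul_pos (Real.rpow_pos_of_pos (by positivity) _) (Real.Gamma_pos_of_pos hs)
  rw [← h]
  symm
  apply ofReal_integral_eq_lintegral_ofReal
  · by_contra hc
    rw [integral_undef hc] at h
    linarith
  · filter_upwards [ae_restrict_mem measurableSet_Ioi] with t ht
    have : 0 < t := ht
    simp only [Pi.zero_apply]
    positivity

lemma lintegral_gauss_aux (d : ℕ) (t : ℝ) (ht : 0 < t) :
    ∫⁻ x : EuclideanSpace ℝ (Fin d), ENNReal.ofReal (Real.exp (-t * ‖x‖ ^ 2))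
      = ENNReal.ofReal ((Real.pi / t) ^ ((d:ℝ) / 2)) := by
  have h := GaussianFourier.integral_rexp_neg_mul_sq_norm (V := EuclideanSpace ℝ (Fin d)) ht
  rw [finrank_euclideanSpace_fin] at h
  have hpos : 0 < (Real.pi / t) ^ ((d:ℝ) / 2) := Real.rpow_pos_of_pos (by positivity) _
  rw [← h]
  symm
  apply ofReal_integral_eq_lintegral_ofReal
  · by_contra hc
    rw [integral_undef hc] at h
    linarith
  · filter_upwards with x
    simp only [Pi.zero_apply]
    positivity

lemma lintegral_weight_aux (d : ℕ) (a : ℝ) (ha : 0 < a) :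
    ∫⁻ x : EuclideanSpace ℝ (Fin d),
        ENNReal.ofReal ((1 / (a + ‖x‖ ^ 2)) ^ (((d:ℝ) + 1) / 2))
      = ENNReal.ofReal ((1 / a) ^ (1 / 2 : ℝ) * Real.pi ^ (((d:ℝ) + 1) / 2)
          / Real.Gamma (((d:ℝ) + 1) / 2)) := by
  set s : ℝ := ((d:ℝ) + 1) / 2 with hs
  have hs0 : 0 < s := by positivity
  have hG : 0 < Real.Gamma s := Real.Gamma_pos_of_pos hs0
  have h1 : ∀ x : EuclideanSpace ℝ (Fin d),
      ENNReal.ofReal ((1 / (a + ‖x‖ ^ 2)) ^ s) =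
      ENNReal.ofReal (1 / Real.Gamma s) * ∫⁻ t in Set.Ioi (0:ℝ),
        ENNReal.ofReal (t ^ (s - 1) * Real.exp (-((a + ‖x‖ ^ 2) * t))) := by
    intro x
    rw [lintegral_gamma_aux s _ hs0 (by positivity), ← ENNReal.ofReal_mul (by positivity)]
    congr 1
    field_simp
  simp_rw [h1]
  rw [lintegral_const_mul' _ _ ENNReal.ofReal_ne_top, lintegral_lintegral_swap]
  · have h2 : ∀ t ∈ Set.Ioi (0:ℝ), ∫⁻ x : EuclideanSpace ℝ (Fin d),
        ENNReal.ofReal (t ^ (s - 1) * Real.exp (-((a + ‖x‖ ^ 2) * t))) =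
        ENNReal.ofReal (Real.pi ^ ((d:ℝ) / 2)) *
          ENNReal.ofReal (t ^ ((1 / 2 : ℝ) - 1) * Real.exp (-(a * t))) := by
      intro t ht
      have ht : 0 < t := ht
      have h3 : ∀ x : EuclideanSpace ℝ (Fin d),
          ENNReal.ofReal (t ^ (s - 1) * Real.exp (-((a + ‖x‖ ^ 2) * t))) =
          ENNReal.ofReal (t ^ (s - 1) * Real.exp (-(a * t))) *
            ENNReal.ofReal (Real.exp (-t * ‖x‖ ^ 2)) := by
        intro x
        rw [← ENNReal.ofReal_mul (by positivity), mul_assoc, ← Real.exp_add]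
        ring_nf
      simp_rw [h3]
      rw [lintegral_const_mul' _ _ ENNReal.ofReal_ne_top, lintegral_gauss_aux d t ht,
        ← ENNReal.ofReal_mul (by positivity), ← ENNReal.ofReal_mul (by positivity)]
      congr 1
      rw [Real.div_rpow Real.pi_pos.le ht.le]
      have : t ^ (s - 1) = t ^ ((1 / 2 : ℝ) - 1) * t ^ ((d:ℝ) / 2) := by
        rw [← Real.rpow_add ht]
        congr 1
        rw [hs]; ring
      rw [this]
      have : t ^ ((d:ℝ) / 2) ≠ 0 := (Real.rpow_pos_of_pos ht _).ne'
      field_simp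
    rw [setLIntegral_congr_fun measurableSet_Ioi h2,
      lintegral_const_mul' _ _ ENNReal.ofReal_ne_top,
      lintegral_gamma_aux _ _ (by norm_num) ha, ← ENNReal.ofReal_mul (by positivity),
      ← ENNReal.ofReal_mul (by positivity), Real.Gamma_one_half_eq]
    congr 1
    have : Real.pi ^ s = Real.pi ^ ((d:ℝ) / 2) * √Real.pi := by
      rw [Real.sqrt_eq_rpow, ← Real.rpow_add Real.pi_pos]
      congr 1
      rw [hs]; ring
    rw [this]
    ring
  · apply Measurable.aemeasurable
    simp only [Function.uncurry_def]
    fun_prop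

lemma rpow_add_aux {x y s : ℝ} (hx : 0 ≤ x) (hy : 0 ≤ y) (hs : 1 ≤ s) :
    (x + y) ^ s ≤ 2 ^ (s - 1) * (x ^ s + y ^ s) := by
  lift x to NNReal using hx
  lift y to NNReal using hy
  exact_mod_cast NNReal.rpow_add_le_mul_rpow_add_rpow x y hs

set_option maxHeartbeats 1000000 in
/-- Multidimensional Carlson inequality: for a probability density `f` on `ℝ^d`
with finite `(d+1)`-moment `I(f)`,
`∫ √f ≤ A_d · I(f)^{d/(2(d+1))}` where `A_d = ((2π)^{(d+1)/2}/Γ((d+1)/2))^{1/2}`. -/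
theorem carlson_inequality (d : ℕ) (hd : 1 ≤ d)
    (f : EuclideanSpace ℝ (Fin d) → ℝ) (hfmeas : Measurable f)
    (hfnonneg : ∀ x, 0 ≤ f x) (hfint : Integrable f)
    (hfprob : ∫ x, f x = 1)
    (hmom : Integrable (fun x => ‖x‖ ^ (d + 1) * f x)) :
    ∫⁻ x, ENNReal.ofReal (Real.sqrt (f x)) ≤
      ENNReal.ofReal
        (Real.sqrt ((2 * Real.pi) ^ (((d:ℝ) + 1) / 2) / Real.Gamma (((d:ℝ) + 1) / 2)) *
          (∫ x, ‖x‖ ^ (d + 1) * f x) ^ ((d:ℝ) / (2 * ((d:ℝ) + 1)))) := by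
  have hd1 : (1:ℝ) ≤ d := by exact_mod_cast hd
  have : Nonempty (Fin d) := ⟨⟨0, hd⟩⟩
  have hnn : ∀ x, 0 ≤ ‖x‖ ^ (d + 1) * f x := fun x => mul_nonneg (by positivity) (hfnonneg x)
  have hI : 0 < ∫ x, ‖x‖ ^ (d + 1) * f x := by
    rcases (integral_nonneg (μ := volume) (f := fun x => ‖x‖ ^ (d + 1) * f x) hnn).lt_or_eq with h | h
    · exact h
    exfalso
    have h0 := (integral_eq_zero_iff_of_nonneg (f := fun x => ‖x‖ ^ (d + 1) * f x) hnn hmom).1 h.symm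
    have : f =ᵐ[volume] 0 := by
      have hz : ∀ᵐ x : EuclideanSpace ℝ (Fin d), x ≠ 0 := by
        rw [ae_iff]; simp
      filter_upwards [h0, hz] with x hx hx0
      simpa [hx0] using hx
    rw [integral_congr_ae this] at hfprob
    simp at hfprob
  generalize hIdef : ∫ x, ‖x‖ ^ (d + 1) * f x = I at *
  set s : ℝ := ((d:ℝ) + 1) / 2 with hs
  have hs0 : 0 < s := by positivity
  have hs1 : 1 ≤ s := by rw [hs]; linarith
  have hG : 0 < Real.Gamma s := Real.Gamma_pos_of_pos hs0
  set a : ℝ := I ^ (1 / s) with hadef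
  have ha : 0 < a := Real.rpow_pos_of_pos hI _
  have has : a ^ s = I := by
    rw [hadef, ← Real.rpow_mul hI.le]
    field_simp
    simp
  have hA : ∫⁻ x, ENNReal.ofReal (f x * (a + ‖x‖ ^ 2) ^ s) ≤ ENNReal.ofReal (2 ^ s * I) := by
    have hint : Integrable (fun x => 2 ^ (s - 1) * (I * f x + ‖x‖ ^ (d + 1) * f x)) :=
      ((hfint.const_mul I).add hmom).const_mul _
    have hval : ∫ x, 2 ^ (s - 1) * (I * f x + ‖x‖ ^ (d + 1) * f x) = 2 ^ s * I := by
      rw [integral_const_mul, integral_add (hfint.const_mul I) hmom, integral_const_mul, hfprob,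
        hIdef, Real.rpow_sub_one (by norm_num)]
      ring
    rw [← hval, ofReal_integral_eq_lintegral_ofReal hint]
    · apply lintegral_mono
      intro x
      apply ENNReal.ofReal_le_ofReal
      have hx : (‖x‖ ^ 2) ^ s = ‖x‖ ^ (d + 1) := by
        rw [← Real.rpow_natCast, ← Real.rpow_natCast, ← Real.rpow_mul (norm_nonneg _)]
        congr 1
        rw [hs]; push_cast; ring
      have := rpow_add_aux ha.le (sq_nonneg ‖x‖) hs1
      rw [has, hx] at this
      have := mul_le_mul_of_nonneg_left this (hfnonneg x)
      linarith
    · filter_upwards with x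
      exact mul_nonneg (by positivity) (add_nonneg (mul_nonneg hI.le (hfnonneg x)) (hnn x))
  have hCS := ENNReal.lintegral_mul_le_Lp_mul_Lq
    (volume : Measure (EuclideanSpace ℝ (Fin d))) Real.HolderConjugate.two_two
    (f := fun x => ENNReal.ofReal (√(f x * (a + ‖x‖ ^ 2) ^ s)))
    (g := fun x => ENNReal.ofReal (√((1 / (a + ‖x‖ ^ 2)) ^ s)))
    (by fun_prop) (by fun_prop)
  have hsq : ∀ y : ℝ, 0 ≤ y → ENNReal.ofReal (√y) ^ (2:ℝ) = ENNReal.ofReal y := by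
    intro y hy
    rw [ENNReal.ofReal_rpow_of_nonneg (by positivity) (by norm_num)]
    norm_num [Real.sq_sqrt hy]
  have e1 : ∀ x, ENNReal.ofReal (√(f x * (a + ‖x‖ ^ 2) ^ s)) ^ (2:ℝ) =
      ENNReal.ofReal (f x * (a + ‖x‖ ^ 2) ^ s) := fun x =>
    hsq _ (mul_nonneg (hfnonneg x) (by positivity))
  have e2 : ∀ x : EuclideanSpace ℝ (Fin d), ENNReal.ofReal (√((1 / (a + ‖x‖ ^ 2)) ^ s)) ^ (2:ℝ) =
      ENNReal.ofReal ((1 / (a + ‖x‖ ^ 2)) ^ s) := fun x => hsq _ (by positivity)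
  have e3 : ∀ x, ENNReal.ofReal (√(f x * (a + ‖x‖ ^ 2) ^ s)) *
      ENNReal.ofReal (√((1 / (a + ‖x‖ ^ 2)) ^ s)) = ENNReal.ofReal (√(f x)) := by
    intro x
    have hw : 0 < a + ‖x‖ ^ 2 := by positivity
    have : (a + ‖x‖ ^ 2) ^ s ≠ 0 := (Real.rpow_pos_of_pos hw _).ne'
    rw [← ENNReal.ofReal_mul (by positivity),
      ← Real.sqrt_mul (mul_nonneg (hfnonneg x) (by positivity)),
      Real.div_rpow (by norm_num) hw.le, Real.one_rpow]
    congr 2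
    field_simp
  simp only [Pi.mul_apply, e1, e2, e3] at hCS
  rw [lintegral_weight_aux d a ha, ← hs] at hCS
  refine hCS.trans ?_
  refine (mul_le_mul_left (ENNReal.rpow_le_rpow hA (by norm_num)) _).trans ?_
  rw [ENNReal.ofReal_rpow_of_nonneg (by positivity) (by norm_num),
    ENNReal.ofReal_rpow_of_nonneg (by positivity) (by norm_num),
    ← ENNReal.ofReal_mul (by positivity)]
  apply ENNReal.ofReal_le_ofReal
  apply le_of_eq
  rw [← Real.mul_rpow (by positivity) (by positivity), Real.sqrt_eq_rpow]
  have : I ^ ((d:ℝ) / (2 * ((d:ℝ) + 1))) = (I ^ ((d:ℝ) / ((d:ℝ) + 1))) ^ (1 / 2 : ℝ) := by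
    rw [← Real.rpow_mul hI.le]
    congr 1
    field_simp
  rw [this, ← Real.mul_rpow (by positivity) (by positivity)]
  congr 1
  have h5 : I ^ ((d:ℝ) / ((d:ℝ) + 1)) = I * (1 / a) ^ (1 / 2 : ℝ) := by
    rw [one_div a, hadef, ← Real.rpow_neg hI.le, ← Real.rpow_mul hI.le]
    nth_rewrite 2 [← Real.rpow_one I]
    rw [← Real.rpow_add hI]
    congr 1
    rw [hs]
    field_simp
    ring
  rw [h5, Real.mul_rpow (by norm_num) Real.pi_pos.le]
  ring
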